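/- arXiv:1703.00988 — 2 statements merged into one kernel-verified Lean document; each statement's English description precedes it below -/
import Mathlib

section
/- If A is a finite noncyclic abelian group acting coprimely by automorphisms on a finite group G, then G is generated by the subgroups C_G(B), where B ranges over subgroups of A such that A/B is cyclic. -/
/-- The subgroup of elements of `G` fixed by every automorphism `φ a`, `a ∈ S`. -/
def fixedSubgroup {A G : Type*} [Group G] (φ : A → MulAut G) (S : Set A) : Subgroup G where
  carrier := {g | ∀ a ∈ S, φ a g = g}
  one_mem' := by intro a _; simp
  mul_mem' := by intro x y hx hy a ha; rw [map_mul, hx a ha, hy a ha]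
  inv_mem' := by intro x hx a ha; rw [map_inv, hx a ha]

open Function in
theorem aux_card_fixed {X : Type*} [Finite X] {p : ℕ} (hp : p.Prime) (f : X → X)
    (hf : ∀ x, f^[p] x = x) : Nat.card X ≡ Nat.card {x // f x = x} [MOD p] := by
  classical
  have := Fintype.ofFinite X
  have : Fact p.Prime := ⟨hp⟩
  have h1 : ∀ n : ℕ, (show Function.End X from f) ^ n = f^[n] := by
    intro n
    induction n with
    | zero => rfl
    | succ n ih => rw [pow_succ, ih]; rfl
  have h := Equiv.Perm.card_fixedPoints_modEq (f := (show Function.End X from f)) (p := p) (n := 1)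
    (by rw [pow_one, h1]; funext x; exact hf x)
  rw [Nat.card_eq_fintype_card]
  refine h.trans ?_
  rw [← Nat.card_eq_fintype_card]
  exact congrArg (· % p) rfl

theorem aux_exists_fixed {X : Type*} [Finite X] {p : ℕ} (hp : p.Prime) (f : X → X)
    (hf : ∀ x, f^[p] x = x) (hX : ¬ p ∣ Nat.card X) : ∃ x, f x = x := by
  by_contra hcon
  push Not at hcon
  have h := aux_card_fixed hp f hf
  have : IsEmpty {x // f x = x} := ⟨fun x => hcon x.1 x.2⟩
  rw [Nat.card_of_isEmpty (α := {x // f x = x})] at h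
  exact hX (Nat.modEq_zero_iff_dvd.mp h)

theorem aux_exists_fixed₂ {X : Type*} [Finite X] {p : ℕ} (hp : p.Prime) (f g : X → X)
    (hf : ∀ x, f^[p] x = x) (hg : ∀ x, g^[p] x = x) (hc : ∀ x, f (g x) = g (f x))
    (hX : ¬ p ∣ Nat.card X) : ∃ x, f x = x ∧ g x = x := by
  have h := aux_card_fixed hp f hf
  let g' : {x // f x = x} → {x // f x = x} := fun x => ⟨g x.1, by rw [hc, x.2]⟩
  have hs : Function.Semiconj (Subtype.val : {x // f x = x} → X) g' g := fun x => rfl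
  obtain ⟨x, hx⟩ := aux_exists_fixed hp g' (fun x => Subtype.ext (by
    rw [(hs.iterate_right p) x, hg])) (fun hd => hX (by
      exact (Nat.modEq_zero_iff_dvd.mp (h.trans (Nat.modEq_zero_iff_dvd.mpr hd)))))
  exact ⟨x.1, x.2, congrArg Subtype.val hx⟩

/-- norm products are fixed -/
theorem aux_norm {G : Type*} [CommGroup G] {p : ℕ} (f : G →* G) (hf : ∀ x, f^[p] x = x) (g : G) :
    f (∏ i ∈ Finset.range p, f^[i] g) = ∏ i ∈ Finset.range p, f^[i] g := by
  rw [map_prod]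
  simp_rw [← Function.iterate_succ_apply' f]
  have h1 := Finset.prod_range_succ (fun i => f^[i] g) p
  have h2 := Finset.prod_range_succ' (fun i => f^[i] g) p
  rw [h1, hf, Function.iterate_zero_apply] at h2
  exact (mul_right_cancel h2).symm

/-- the composite `α β^i` -/
def auxComp {G : Type*} [Group G] (α β : G →* G) (i : ℕ) : G →* G where
  toFun x := α (β^[i] x)
  map_one' := by simp
  map_mul' x y := by simp [iterate_map_mul]

theorem auxComp_iterate {G : Type*} [Group G] (α β : G →* G)
    (hc : ∀ x, α (β x) = β (α x)) (i j : ℕ) (x : G) :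
    (auxComp α β i)^[j] x = α^[j] ((β^[j])^[i] x) := by
  have hcc : Function.Commute α β := hc
  have e : (auxComp α β i : G → G) = α ∘ β^[i] := rfl
  rw [e, (hcc.iterate_right i).comp_iterate j, Function.comp_apply, ← Function.iterate_mul,
    ← Function.iterate_mul, mul_comm]

theorem auxComp_period {G : Type*} [Group G] {p : ℕ} (α β : G →* G)
    (hα : ∀ x, α^[p] x = x) (hβ : ∀ x, β^[p] x = x)
    (hc : ∀ x, α (β x) = β (α x)) (i : ℕ) (x : G) :
    (auxComp α β i)^[p] x = x := by
  rw [auxComp_iterate α β hc]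
  have : (β^[p] : G → G) = id := funext hβ
  rw [this, Function.iterate_id, hα]; rfl

theorem aux_comm {G : Type*} [CommGroup G] [Finite G] {p : ℕ} (hp : p.Prime)
    (hG : ¬ p ∣ Nat.card G) (α β : G →* G)
    (hα : ∀ x, α^[p] x = x) (hβ : ∀ x, β^[p] x = x)
    (hc : ∀ x, α (β x) = β (α x)) (T : Subgroup G)
    (h1 : ∀ g, β g = g → g ∈ T) (h2 : ∀ i : ℕ, ∀ g, α (β^[i] g) = g → g ∈ T) (g : G) :
    g ∈ T := by
  have hcc : Function.Commute α β := hc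
  have hcop : (Nat.card G).Coprime p := ((Nat.Prime.coprime_iff_not_dvd hp).2 hG).symm
  -- it suffices to consider p-th powers
  have key : ∀ g : G, g ^ p ∈ T := by
    intro g
    have hA : (∏ i ∈ Finset.range p, ∏ j ∈ Finset.range p, (auxComp α β i)^[j] g) ∈ T :=
      Subgroup.prod_mem _ fun i _ => h2 i _
        (aux_norm (auxComp α β i) (auxComp_period α β hα hβ hc i) g)
    rw [Finset.prod_comm] at hA
    have hterm : ∀ j ∈ Finset.range p, j ≠ 0 →
        (∏ i ∈ Finset.range p, (auxComp α β i)^[j] g) ∈ T := by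
      intro j hj hj0
      apply h1
      have hjp : Nat.gcd j p = 1 := by
        have := (Nat.Prime.coprime_iff_not_dvd hp).2
          (fun h => absurd (Nat.le_of_dvd (Nat.pos_of_ne_zero hj0) h)
            (not_le.2 (Finset.mem_range.1 hj)))
        exact this.symm
      simp_rw [auxComp_iterate α β hc]
      -- the hom β^j
      let b : G →* G := 
        { toFun := β^[j], map_one' := by simp, map_mul' := fun x y => by simp [iterate_map_mul] }
      let a : G →* G := 
        { toFun := α^[j], map_one' := by simp, map_mul' := fun x y => by simp [iterate_map_mul] }
      have hb : ∀ x, b^[p] x = x := fun x => by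
        change (β^[j])^[p] x = x
        rw [← Function.iterate_mul, mul_comm, Function.iterate_mul]
        have : (β^[p] : G → G) = id := funext hβ
        rw [this, Function.iterate_id]; rfl
      have hN := aux_norm b hb g
      set y := ∏ i ∈ Finset.range p, b^[i] g with hy
      have e : (∏ i ∈ Finset.range p, α^[j] ((β^[j])^[i] g)) = a y := by
        rw [hy, map_prod]; rfl
      rw [e]
      have hy1 : β y = y := by
        have p1 : Function.IsPeriodicPt β j y := hN
        have p2 : Function.IsPeriodicPt β p y := hβ y
        have := p1.gcd p2
        rw [hjp] at this
        exact this
      change β (α^[j] y) = α^[j] y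
      rw [← (hcc.iterate_left j) y, hy1]
    rw [← Finset.mul_prod_erase _ _ (Finset.mem_range.2 hp.pos)] at hA
    have hB : (∏ j ∈ (Finset.range p).erase 0, 
        ∏ i ∈ Finset.range p, (auxComp α β i)^[j] g) ∈ T :=
      Subgroup.prod_mem _ fun j hj => hterm j (Finset.mem_of_mem_erase hj) 
        (Finset.ne_of_mem_erase hj)
    have := (Subgroup.mul_mem_cancel_right T hB).1 hA
    simpa using this
  obtain ⟨x, rfl⟩ := (powCoprime hcop).surjective g
  exact key x

/-- lifting fixed points through a quotient -/
theorem aux_lift {G : Type*} [Group G] [Finite G] {p : ℕ} (hp : p.Prime)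
    (hG : ¬ p ∣ Nat.card G) (N : Subgroup G) [N.Normal] (f : G →* G) (hf : ∀ x, f^[p] x = x)
    (fb : G ⧸ N →* G ⧸ N) (hfb : ∀ x : G, fb (x : G ⧸ N) = (f x : G))
    (x : G ⧸ N) (hx : fb x = x) : ∃ g : G, (g : G ⧸ N) = x ∧ f g = g := by
  let X := {g : G // (g : G ⧸ N) = x}
  let f' : X → X := fun g => ⟨f g.1, by rw [← hfb, g.2, hx]⟩
  have hs : Function.Semiconj (Subtype.val : X → G) f' f := fun x => rfl
  have hcard : Nat.card X = Nat.card N := by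
    obtain ⟨g, rfl⟩ := QuotientGroup.mk_surjective x
    refine Nat.card_congr ?_
    exact
      { toFun := fun y => ⟨g⁻¹ * y.1, QuotientGroup.eq.1 y.2.symm⟩
        invFun := fun n => ⟨g * n.1, by simp⟩
        left_inv := fun y => by simp
        right_inv := fun y => by simp }
  obtain ⟨y, hy⟩ := aux_exists_fixed hp f' (fun y => Subtype.ext (by
    rw [(hs.iterate_right p) y, hf])) (by
      rw [hcard]; exact fun h => hG (h.trans (Subgroup.card_subgroup_dvd_card N)))
  exact ⟨y.1, y.2, congrArg Subtype.val hy⟩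

open scoped Pointwise in
/-- invariant Sylow subgroups -/
theorem aux_sylow {G : Type*} [Group G] [Finite G] {p : ℕ} (hp : p.Prime)
    (hG : ¬ p ∣ Nat.card G) (α β : G →* G)
    (hα : ∀ x, α^[p] x = x) (hβ : ∀ x, β^[p] x = x)
    (hc : ∀ x, α (β x) = β (α x)) (q : ℕ) [Fact q.Prime] :
    ∃ P : Sylow q G, (∀ x ∈ P, α x ∈ P) ∧ (∀ x ∈ P, β x ∈ P) := by
  have mk : ∀ f : G →* G, (∀ x, f^[p] x = x) → ∃ F : MulAut G, (∀ x, F x = f x) ∧ F ^ p = 1 := by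
    intro f hf
    have hinj : Function.Injective f := by
      have : Function.Injective (f^[p]) := fun x y h => by rwa [hf, hf] at h
      have e : p = (p - 1) + 1 := (Nat.succ_pred_eq_of_pos hp.pos).symm
      rw [e, Function.iterate_succ] at this
      exact this.of_comp
    refine ⟨MulEquiv.ofBijective f (Finite.injective_iff_bijective.1 hinj), fun x => rfl, ?_⟩
    ext x
    have : ∀ n : ℕ, ((MulEquiv.ofBijective f (Finite.injective_iff_bijective.1 hinj) : 
      MulAut G) ^ n) x = f^[n] x := by
      intro n
      induction n with
      | zero => rfl
      | succ n ih => rw [pow_succ', MulAut.mul_apply, ih, Function.iterate_succ_apply']; rfl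
    rw [this, hf]; rfl
  obtain ⟨F, hF, hFp⟩ := mk α hα
  obtain ⟨H, hH, hHp⟩ := mk β hβ
  have hFH : F * H = H * F := by
    ext x; simp [hF, hH, hc]
  obtain ⟨P0⟩ : Nonempty (Sylow q G) := inferInstance
  obtain ⟨P, hP1, hP2⟩ := aux_exists_fixed₂ hp (fun P : Sylow q G => F • P) (fun P => H • P)
    (fun P => by rw [smul_iterate, hFp]; exact one_smul _ P) 
    (fun P => by rw [smul_iterate, hHp]; exact one_smul _ P)
    (fun P => by simp only [← mul_smul, hFH])
    (fun h => hG (h.trans (P0.card_dvd_index.trans P0.1.index_dvd_card)))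
  have fin : ∀ K : MulAut G, K • P = P → ∀ x ∈ P, K x ∈ P := by
    intro K hK x hx
    have : K • x ∈ (K • (P : Subgroup G)) := Subgroup.smul_mem_pointwise_smul x K _ hx
    rw [← Sylow.pointwise_smul_def, hK] at this
    exact this
  exact ⟨P, fun x hx => by rw [← hF]; exact fin F hP1 x hx, 
    fun x hx => by rw [← hH]; exact fin H hP2 x hx⟩

theorem aux_main (n : ℕ) : ∀ {G : Type*} [Group G] [Finite G] (_ : Nat.card G = n) {p : ℕ} 
    (_ : p.Prime) (_ : ¬ p ∣ Nat.card G) (α β : G →* G)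
    (_ : ∀ x, α^[p] x = x) (_ : ∀ x, β^[p] x = x)
    (_ : ∀ x, α (β x) = β (α x)) (T : Subgroup G)
    (_ : ∀ g, β g = g → g ∈ T) (_ : ∀ i : ℕ, ∀ g, α (β^[i] g) = g → g ∈ T), T = ⊤ := by
  induction n using Nat.strong_induction_on with
  | _ n ih =>
  intro G _ _ hn p hp hG α β hα hβ hc T h1 h2
  -- restriction to subgroups
  have sub : ∀ (H : Subgroup G) (hHα : ∀ x ∈ H, α x ∈ H) (hHβ : ∀ x ∈ H, β x ∈ H),
      ∃ a b : H →* H, (∀ x, a^[p] x = x) ∧ (∀ x, b^[p] x = x) ∧ (∀ x, a (b x) = b (a x)) ∧ 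
      (∀ g, b g = g → g ∈ T.subgroupOf H) ∧ 
      (∀ i : ℕ, ∀ g, a (b^[i] g) = g → g ∈ T.subgroupOf H) ∧ ¬ p ∣ Nat.card H := by
    intro H hHα hHβ
    let a : H →* H := (α.comp H.subtype).codRestrict H fun x => hHα x x.2
    let b : H →* H := (β.comp H.subtype).codRestrict H fun x => hHβ x x.2
    have sa : Function.Semiconj (Subtype.val : H → G) a α := fun x => rfl
    have sb : Function.Semiconj (Subtype.val : H → G) b β := fun x => rfl
    refine ⟨a, b, fun x => Subtype.ext ?_, fun x => Subtype.ext ?_, fun x => Subtype.ext (hc x), 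
      fun g hg => ?_, fun i g hg => ?_, 
      fun h => hG (h.trans (Subgroup.card_subgroup_dvd_card H))⟩
    · rw [(sa.iterate_right p) x, hα]
    · rw [(sb.iterate_right p) x, hβ]
    · exact h1 _ (congrArg Subtype.val hg)
    · have := congrArg Subtype.val hg
      refine h2 i _ ?_
      change α (β^[i] (g : G)) = (g : G)
      rw [← (sb.iterate_right i) g, ← sa]
      exact this
  have surj : ∀ f : G →* G, (∀ x, f^[p] x = x) → Function.Surjective f := by
    intro f hf x
    refine ⟨f^[p-1] x, ?_⟩
    rw [← Function.iterate_succ_apply' f, Nat.succ_eq_add_one, Nat.sub_add_cancel hp.pos, hf]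
  by_cases hZ : Subgroup.center G = ⊥
  · -- all Sylow subgroups are proper
    by_contra hT
    have hidx : T.index ≠ 1 := fun h => hT (Subgroup.index_eq_one.1 h)
    obtain ⟨q, hq, hqd⟩ := Nat.exists_prime_and_dvd hidx
    have : Fact q.Prime := ⟨hq⟩
    obtain ⟨P, hPα, hPβ⟩ := aux_sylow hp hG α β hα hβ hc q
    have hPT : (P : Subgroup G) ≤ T := by
      obtain ⟨a, b, ha, hb, hab, t1, t2, hd⟩ := sub P hPα hPβ
      have hlt : Nat.card P < n := by
        rw [← hn]
        refine lt_of_le_of_ne (Subgroup.card_le_card_group _) fun he => ?_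
        have htop : (P : Subgroup G) = ⊤ := Subgroup.eq_top_of_card_eq _ he
        have hpg : IsPGroup q G := by
          have := P.2
          rw [htop] at this
          exact this.of_equiv Subgroup.topEquiv
        rcases subsingleton_or_nontrivial G with hs | hs
        · exact hT (Subsingleton.elim _ _)
        · have := hpg.center_nontrivial
          exact (Subgroup.nontrivial_iff_ne_bot _).1 this hZ
      have := ih _ hlt (G := P) rfl hp hd a b ha hb hab _ t1 t2
      exact Subgroup.subgroupOf_eq_top.1 this
    exact P.not_dvd_index (hqd.trans (Subgroup.index_dvd_of_le hPT))
  · have cen : ∀ f : G →* G, (∀ x, f^[p] x = x) → ∀ x ∈ Subgroup.center G, 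
        f x ∈ Subgroup.center G := by
      intro f hf x hx
      rw [Subgroup.mem_center_iff] at hx ⊢
      intro g
      obtain ⟨y, rfl⟩ := surj f hf g
      rw [← map_mul, ← map_mul, hx]
    have hZT : Subgroup.center G ≤ T := by
      obtain ⟨a, b, ha, hb, hab, t1, t2, hd⟩ := sub _ (cen α hα) (cen β hβ)
      intro z hz
      let _ : CommGroup (Subgroup.center G) :=
        { (inferInstance : Group (Subgroup.center G)) with
          mul_comm := fun x y => Subtype.ext (Subgroup.mem_center_iff.1 y.2 x) }
      exact aux_comm hp hd a b ha hb hab _ t1 t2 ⟨z, hz⟩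
    let Z := Subgroup.center G
    let a : G ⧸ Z →* G ⧸ Z := QuotientGroup.map Z Z α (cen α hα)
    let b : G ⧸ Z →* G ⧸ Z := QuotientGroup.map Z Z β (cen β hβ)
    have sa : Function.Semiconj (QuotientGroup.mk : G → G ⧸ Z) α a := fun x => rfl
    have sb : Function.Semiconj (QuotientGroup.mk : G → G ⧸ Z) β b := fun x => rfl
    have hmul : Nat.card G = Nat.card (G ⧸ Z) * Nat.card Z := 
      Subgroup.card_eq_card_quotient_mul_card_subgroup Z
    have hlt : Nat.card (G ⧸ Z) < n := by
      have h2 : 1 < Nat.card Z := by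
        rw [Finite.one_lt_card_iff_nontrivial]
        exact (Subgroup.nontrivial_iff_ne_bot _).2 hZ
      have h3 : 0 < Nat.card (G ⧸ Z) := Nat.card_pos
      rw [← hn, hmul]
      nlinarith
    have := ih _ hlt (G := G ⧸ Z) rfl hp (fun h => hG (hmul ▸ h.mul_right _)) a b 
      (fun x => by
        obtain ⟨x, rfl⟩ := QuotientGroup.mk_surjective x
        rw [← (sa.iterate_right p) x, hα])
      (fun x => by
        obtain ⟨x, rfl⟩ := QuotientGroup.mk_surjective x
        rw [← (sb.iterate_right p) x, hβ])
      (fun x => by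
        obtain ⟨x, rfl⟩ := QuotientGroup.mk_surjective x
        exact congrArg QuotientGroup.mk (hc x)) (T.map (QuotientGroup.mk' Z)) 
      (fun x hx => by
        obtain ⟨g, rfl, hg⟩ := aux_lift hp hG Z β hβ b (fun x => rfl) x hx
        exact ⟨g, h1 g hg, rfl⟩)
      (fun i x hx => by
        obtain ⟨g, rfl, hg⟩ := aux_lift hp hG Z (auxComp α β i) (auxComp_period α β hα hβ hc i) 
          (auxComp a b i) (fun x => by
            change a (b^[i] x) = _
            rw [← (sb.iterate_right i) x, ← sa]; rfl) x hx
        exact ⟨g, h2 i g hg, rfl⟩)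
    rw [eq_top_iff]
    intro g _
    have hg : (g : G ⧸ Z) ∈ T.map (QuotientGroup.mk' Z) := by rw [this]; trivial
    obtain ⟨t, ht, hte⟩ := hg
    have : t⁻¹ * g ∈ Z := QuotientGroup.eq.1 hte
    have := T.mul_mem ht (hZT this)
    simpa using this

/-- noncyclic abelian groups have two independent elements of order `p` -/
theorem aux_noncyclic {A : Type*} [CommGroup A] [Finite A] (h : ¬ IsCyclic A) :
    ∃ p : ℕ, p.Prime ∧ p ∣ Nat.card A ∧ ∃ a b : A, a ^ p = 1 ∧ b ^ p = 1 ∧ b ≠ 1 ∧ 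
      ∀ i : ℕ, a * b ^ i ≠ 1 := by
  classical
  have hex : ∃ p : ℕ, p.Prime ∧ p < Nat.card (powMonoidHom p : A →* A).ker := by
    by_contra hcon
    push Not at hcon
    apply h
    have : Fintype A := Fintype.ofFinite A
    have hle : ∀ n : ℕ, 0 < n → Nat.card (powMonoidHom n : A →* A).ker ≤ n := by
      intro n
      induction n using Nat.recOnMul with
      | zero => simp
      | one => 
        intro _
        have : (powMonoidHom 1 : A →* A).ker = ⊥ := by
          ext x; simp
        rw [this]; simp
      | prime p hp => intro _; exact hcon p hp
      | mul m n hm hn => 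
        intro hmn
        have hm0 : 0 < m := Nat.pos_of_mul_pos_right hmn
        have hn0 : 0 < n := Nat.pos_of_mul_pos_left hmn
        let K := (powMonoidHom (m * n) : A →* A).ker
        let f : K →* (powMonoidHom n : A →* A).ker := 
          ((powMonoidHom m : A →* A).comp K.subtype).codRestrict _ (fun x => by
            have hx : x.1 ^ (m * n) = 1 := x.2
            change (x.1 ^ m) ^ n = 1
            rw [← pow_mul, hx])
        have h1 : Nat.card K = Nat.card f.ker * Nat.card f.range := by
          rw [← f.ker.card_mul_index, Subgroup.index_ker]
        have h2 : Nat.card f.range ≤ n := (Subgroup.card_le_card_group _).trans (hn hn0)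
        have h3 : Nat.card f.ker ≤ m := by
          refine le_trans ?_ (hm hm0)
          refine Nat.card_le_card_of_injective 
            (fun x : f.ker => (⟨x.1.1, congrArg Subtype.val x.2⟩ : (powMonoidHom m : A →* A).ker)) ?_
          intro x y hxy
          have hxy2 : x.1.1 = y.1.1 := 
            congrArg (fun z : (powMonoidHom m : A →* A).ker => (z : A)) hxy
          exact Subtype.ext (Subtype.ext hxy2)
        change Nat.card K ≤ _
        rw [h1]
        exact Nat.mul_le_mul h3 h2
    refine isCyclic_of_card_pow_eq_one_le (fun n hn => ?_)
    have := hle n hn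
    rw [Nat.card_eq_fintype_card, Fintype.card_subtype] at this
    simpa [MonoidHom.mem_ker] using this
  obtain ⟨p, hp, hlt⟩ := hex
  have : Nontrivial (powMonoidHom p : A →* A).ker := 
    Finite.one_lt_card_iff_nontrivial.1 (hp.one_lt.trans hlt)
  obtain ⟨⟨b, hb⟩, hb1⟩ := exists_ne (1 : (powMonoidHom p : A →* A).ker)
  have hb : b ^ p = 1 := hb
  have hb1 : b ≠ 1 := fun h => hb1 (Subtype.ext h)
  have hord : orderOf b = p := orderOf_eq_prime hb hb1 (hp := ⟨hp⟩)
  have hnle : ¬ (powMonoidHom p : A →* A).ker ≤ Subgroup.zpowers b := by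
    intro hle
    have := Subgroup.card_le_of_le hle
    rw [Nat.card_zpowers, hord] at this
    omega
  obtain ⟨a, ha, hab⟩ := SetLike.not_le_iff_exists.1 hnle
  refine ⟨p, hp, hord ▸ orderOf_dvd_natCard b, a, b, ha, hb, hb1, fun i hi => hab ?_⟩
  rw [eq_inv_of_mul_eq_one_left hi]
  exact Subgroup.inv_mem _ (Subgroup.pow_mem _ (Subgroup.mem_zpowers b) i)

theorem aux_final {A G : Type*} [CommGroup A] [Finite A] [Group G] [Finite G]
    (φ : A →* MulAut G) (hcop : Nat.Coprime (Nat.card A) (Nat.card G)) (T : Subgroup G)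
    (hT : ∀ B : Subgroup A, IsCyclic (A ⧸ B) → fixedSubgroup (fun a => φ a) (B : Set A) ≤ T)
    (C : Subgroup A) : fixedSubgroup (fun a => φ a) (C : Set A) ≤ T := by
  induction C using WellFoundedGT.induction with
  | _ C ih =>
  by_cases hcyc : IsCyclic (A ⧸ C)
  · exact hT C hcyc
  obtain ⟨p, hp, hpd, a, b, ha, hb, hb1, hab⟩ := aux_noncyclic hcyc
  obtain ⟨a, rfl⟩ := QuotientGroup.mk_surjective a
  obtain ⟨b, rfl⟩ := QuotientGroup.mk_surjective b
  have ha : a ^ p ∈ C := (QuotientGroup.eq_one_iff _).1 ha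
  have hb : b ^ p ∈ C := (QuotientGroup.eq_one_iff _).1 hb
  have hb1 : b ∉ C := fun h => hb1 ((QuotientGroup.eq_one_iff _).2 h)
  have hab : ∀ i : ℕ, a * b ^ i ∉ C := fun i h => hab i ((QuotientGroup.eq_one_iff _).2 h)
  set H := fixedSubgroup (fun a => φ a) (C : Set A) with hH
  have hinv : ∀ x : A, ∀ g ∈ H, φ x g ∈ H := by
    intro x g hg c hc
    change φ c (φ x g) = φ x g
    rw [← MulAut.mul_apply, ← map_mul, mul_comm, map_mul, MulAut.mul_apply]
    exact congrArg _ (hg c hc)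
  let r : A → (H →* H) := fun x => 
    ((φ x).toMonoidHom.comp H.subtype).codRestrict H fun g => hinv x g g.2
  have hr : ∀ x (n : ℕ) (g : H), (((r x)^[n] g : H) : G) = φ (x ^ n) g := by
    intro x n g
    induction n with
    | zero => simp
    | succ n ih =>
      rw [Function.iterate_succ_apply', pow_succ', map_mul, MulAut.mul_apply, ← ih]
      rfl
  have hfix : ∀ x, x ∉ C → ∀ g ∈ H, φ x g = g → g ∈ T := by
    intro x hx g hg hxg
    have hlt : C < C ⊔ Subgroup.zpowers x := by
      refine lt_of_le_of_ne le_sup_left fun he => hx ?_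
      rw [he]
      exact Subgroup.mem_sup_right (Subgroup.mem_zpowers x)
    refine ih _ hlt ?_
    let S : Subgroup A := (MulAction.stabilizer (MulAut G) g).comap φ
    have : C ⊔ Subgroup.zpowers x ≤ S := by
      refine sup_le (fun c hc => hg c hc) ?_
      rw [Subgroup.zpowers_le]
      exact hxg
    exact fun y hy => this hy
  have hpG : ¬ p ∣ Nat.card H := by
    intro h
    have h1 : p ∣ Nat.card G := h.trans (Subgroup.card_subgroup_dvd_card H)
    have h2 : p ∣ Nat.card A := hpd.trans (Subgroup.card_quotient_dvd_card C)
    exact Nat.not_coprime_of_dvd_of_dvd hp.one_lt h2 h1 hcop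
  have := aux_main _ (G := H) rfl hp hpG (r a) (r b) 
    (fun g => Subtype.ext (by rw [hr]; exact g.2 _ ha))
    (fun g => Subtype.ext (by rw [hr]; exact g.2 _ hb))
    (fun g => Subtype.ext (by
      change φ a (φ b g) = φ b (φ a g)
      rw [← MulAut.mul_apply, ← map_mul, mul_comm, map_mul, MulAut.mul_apply]))
    (T.subgroupOf H)
    (fun g hg => hfix b hb1 g g.2 (congrArg Subtype.val hg))
    (fun i g hg => hfix _ (hab i) g g.2 (by
      have := congrArg Subtype.val hg
      rw [map_mul, MulAut.mul_apply, ← hr]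
      exact this))
  exact Subgroup.subgroupOf_eq_top.1 this

/-- if a finite noncyclic abelian group `A` acts coprimely on a finite
group `G`, then `G` is generated by the fixed-point subgroups `C_G(B)` where `B`
ranges over the subgroups of `A` with `A/B` cyclic. -/
theorem stmt_1 {A G : Type*} [CommGroup A] [Finite A] [Group G] [Finite G]
    (hnc : ¬ IsCyclic A)
    (φ : A →* MulAut G) (hcop : Nat.Coprime (Nat.card A) (Nat.card G)) :
    (⨆ B ∈ {B : Subgroup A | IsCyclic (A ⧸ B)},
      fixedSubgroup (fun a => φ a) (B : Set A)) = ⊤ := by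
  rw [eq_top_iff]
  intro g _
  refine aux_final φ hcop _ (fun B hB => ?_) ⊥ ?_
  · exact le_iSup₂_of_le B hB le_rfl
  · intro a ha
    have : a = 1 := ha
    simp [this]
end

section
/- Let q be a prime, A an elementary abelian q-group of order at least q^3 acting coprimely on a finite group G such that C_G(a) is abelian for every nonidentity a ∈ A. Then G is nilpotent of class bounded in terms of q (special case c = 1 of Theorem 1.2). -/
/-- The stabilizer in `A` of an element of `G`. -/
def actStab {A G : Type} [CommGroup A] [Group G] (φ : A →* MulAut G) (x : G) : Subgroup A :=
  (MulAction.stabilizer (MulAut G) x).comap φ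

theorem mem_actStab {A G : Type} [CommGroup A] [Group G] (φ : A →* MulAut G) (x : G) (a : A) :
    a ∈ actStab φ x ↔ φ a x = x := by
  simp [actStab, MulAction.mem_stabilizer_iff]

/-- The subgroup generated by the elements fixed by a subgroup of index at most `q`. -/
def fixGen {A G : Type} [CommGroup A] [Group G] (φ : A →* MulAut G) (q : ℕ) : Subgroup G :=
  Subgroup.closure {x | (actStab φ x).index ≤ q}

/-- The trace (norm) of `v` under the powers of `c`. -/
def traceP {A V : Type} [CommGroup A] [CommGroup V] (φ : A →* MulAut V) (q : ℕ) (c : A) (v : V) : V :=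
  ∏ j ∈ Finset.range q, φ (c ^ j) v

theorem traceP_fixed {A V : Type} [CommGroup A] [CommGroup V] (φ : A →* MulAut V) (q : ℕ)
    (c : A) (hc : c ^ q = 1) (v : V) : φ c (traceP φ q c v) = traceP φ q c v := by
  unfold traceP
  have h1 : φ c (∏ j ∈ Finset.range q, φ (c ^ j) v) = ∏ j ∈ Finset.range q, φ (c ^ (j+1)) v := by
    rw [map_prod]
    refine Finset.prod_congr rfl fun j _ => ?_
    rw [pow_succ', map_mul, MulAut.mul_apply]
  have h2 := Finset.prod_range_succ (fun j => φ (c ^ j) v) q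
  have h3 := Finset.prod_range_succ' (fun j => φ (c ^ j) v) q
  rw [h1]
  rw [h2] at h3
  simp only [hc, pow_zero] at h3
  exact (mul_right_cancel h3).symm

theorem traceP_fixed' {A V : Type} [CommGroup A] [CommGroup V] (φ : A →* MulAut V) (q : ℕ)
    (c d : A) (v : V) (hd : φ d v = v) : φ d (traceP φ q c v) = traceP φ q c v := by
  unfold traceP
  rw [map_prod]
  refine Finset.prod_congr rfl fun j _ => ?_
  rw [← MulAut.mul_apply, ← map_mul, mul_comm, map_mul, MulAut.mul_apply, hd]

theorem prod_mul_mod {V : Type} [CommGroup V] (q j : ℕ) (hq : 0 < q) (hj : Nat.Coprime q j)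
    (f : ℕ → V) (hf : ∀ k, f (k % q) = f k) :
    ∏ i ∈ Finset.range q, f (i * j) = ∏ i ∈ Finset.range q, f i := by
  have hm : Set.MapsTo (fun i => i * j % q) (Finset.range q) (Finset.range q) := by
    intro i _
    simpa using Nat.mod_lt _ hq
  have hi : Set.InjOn (fun i => i * j % q) (Finset.range q) := by
    intro i h i' h' e
    have : i * j ≡ i' * j [MOD q] := e
    have := Nat.ModEq.cancel_right_of_coprime hj this
    exact Nat.ModEq.eq_of_lt_of_lt this (by simpa using h) (by simpa using h')
  refine Finset.prod_nbij (fun i => i * j % q) hm hi ?_ ?_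
  · exact Finset.surjOn_of_injOn_of_card_le _ hm hi le_rfl
  · intro i _
    exact (hf _).symm

theorem trace_identity {A V : Type} [CommGroup A] [CommGroup V] (φ : A →* MulAut V) (q : ℕ)
    (hq : q.Prime) (a b : A) (ha : a ^ q = 1) (v : V) :
    (∏ i ∈ Finset.range q, traceP φ q (b * a ^ i) v) * traceP φ q a v =
      v ^ q * traceP φ q a (traceP φ q b v) := by
  have h0 : traceP φ q a (traceP φ q b v) =
      ∏ j ∈ Finset.range q, ∏ k ∈ Finset.range q, φ (b ^ j * a ^ k) v := by
    rw [Finset.prod_comm]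
    unfold traceP
    refine Finset.prod_congr rfl fun k _ => ?_
    rw [map_prod]
    refine Finset.prod_congr rfl fun j _ => ?_
    rw [← MulAut.mul_apply, ← map_mul, mul_comm]
  have h1 : ∏ i ∈ Finset.range q, traceP φ q (b * a ^ i) v =
      ∏ j ∈ Finset.range q, ∏ i ∈ Finset.range q, φ (b ^ j * a ^ (i * j)) v := by
    rw [Finset.prod_comm]
    unfold traceP
    refine Finset.prod_congr rfl fun k _ => ?_
    refine Finset.prod_congr rfl fun j _ => ?_
    rw [mul_pow, pow_mul]
  rw [h0, h1]
  obtain ⟨n, rfl⟩ : ∃ n, q = n + 1 := ⟨q - 1, by have := hq.pos; omega⟩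
  rw [Finset.prod_range_succ' (fun j => ∏ i ∈ Finset.range (n+1), φ (b ^ j * a ^ (i * j)) v),
    Finset.prod_range_succ' (fun j => ∏ i ∈ Finset.range (n+1), φ (b ^ j * a ^ i) v)]
  have h2 : ∀ j ∈ Finset.range n, ∏ i ∈ Finset.range (n+1), φ (b ^ (j+1) * a ^ (i * (j+1))) v =
      ∏ i ∈ Finset.range (n+1), φ (b ^ (j+1) * a ^ i) v := by
    intro j hj
    refine prod_mul_mod (n+1) (j+1) (Nat.succ_pos _) ?_ (fun k => φ (b ^ (j+1) * a ^ k) v) ?_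
    · rw [Nat.Prime.coprime_iff_not_dvd hq]
      intro h
      have := Nat.le_of_dvd (Nat.succ_pos _) h
      have := Finset.mem_range.1 hj
      omega
    · intro k
      have : a ^ (k % (n+1)) = a ^ k := by
        conv_rhs => rw [← Nat.mod_add_div k (n+1), pow_add, pow_mul, ha, one_pow, mul_one]
      simp only [this]
  rw [Finset.prod_congr rfl h2]
  simp only [traceP, pow_zero, mul_zero, one_mul, map_one, MulAut.one_apply, Finset.prod_const,
    Finset.card_range]
  simp only [mul_comm, mul_left_comm]

theorem fixed_mem_fixGen {A V : Type} [CommGroup A] [Finite A] [CommGroup V] [Finite V]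
    (φ : A →* MulAut V) (q : ℕ) (hq : q.Prime) (hA : ∀ a : A, a ^ q = 1)
    (hc : Nat.Coprime q (Nat.card V)) :
    ∀ (n : ℕ) (D : Subgroup A) (v : V), D.index ≤ n → D ≤ actStab φ v → v ∈ fixGen φ q := by
  intro n
  induction n with
  | zero =>
    intro D v h
    exact absurd (Nat.le_zero.1 h) Subgroup.FiniteIndex.index_ne_zero
  | succ n ih =>
    intro D v hn hD
    by_cases hle : D.index ≤ q
    · exact Subgroup.subset_closure
        (le_trans (Nat.le_of_dvd (Nat.pos_of_ne_zero Subgroup.FiniteIndex.index_ne_zero)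
          (Subgroup.index_dvd_of_le hD)) hle)
    have hgt : q < D.index := not_le.1 hle
    -- the key enlargement step
    have key : ∀ (c : A), c ∉ D → ∀ w : V, D ≤ actStab φ w → φ c w = w → w ∈ fixGen φ q := by
      intro c hcD w hw hcw
      have hlt : D < D ⊔ Subgroup.zpowers c := by
        refine lt_of_le_of_ne le_sup_left fun e => hcD ?_
        rw [e]
        exact Subgroup.mem_sup_right (Subgroup.mem_zpowers c)
      have := Subgroup.index_strictAnti hlt
      refine ih (D ⊔ Subgroup.zpowers c) w (by omega) (sup_le hw ?_)
      rw [Subgroup.zpowers_le, mem_actStab]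
      exact hcw
    obtain ⟨a, ha⟩ : ∃ a, a ∉ D := by
      by_contra! h
      have : D = ⊤ := (Subgroup.eq_top_iff' D).2 h
      rw [this, Subgroup.index_top] at hgt
      have := hq.pos
      omega
    obtain ⟨b, hb⟩ : ∃ b, b ∉ D ⊔ Subgroup.zpowers a := by
      by_contra! h
      have h1 : ∀ x : A ⧸ D, x ∈ Subgroup.zpowers (QuotientGroup.mk a : A ⧸ D) := by
        intro x
        obtain ⟨x, rfl⟩ := QuotientGroup.mk_surjective x
        obtain ⟨d, hd, z, hz, rfl⟩ := Subgroup.mem_sup.1 (h x)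
        obtain ⟨k, rfl⟩ := Subgroup.mem_zpowers_iff.1 hz
        refine Subgroup.mem_zpowers_iff.2 ⟨k, ?_⟩
        rw [QuotientGroup.mk_mul, (QuotientGroup.eq_one_iff d).2 hd, one_mul, QuotientGroup.mk_zpow]
      have h2 := orderOf_eq_card_of_forall_mem_zpowers h1
      have h3 : orderOf (QuotientGroup.mk a : A ⧸ D) ≤ q :=
        orderOf_le_of_pow_eq_one hq.pos (by rw [← QuotientGroup.mk_pow, hA]; rfl)
      rw [h2] at h3
      exact hle h3
    have hbi : ∀ i : ℕ, b * a ^ i ∉ D := by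
      intro i hi
      apply hb
      have h1 : a ^ i ∈ D ⊔ Subgroup.zpowers a :=
        Subgroup.mem_sup_right (Subgroup.npow_mem_zpowers a i)
      have h2 : b * a ^ i ∈ D ⊔ Subgroup.zpowers a := Subgroup.mem_sup_left hi
      exact (Subgroup.mul_mem_cancel_right _ h1).1 h2
    have htr : ∀ c w, D ≤ actStab φ w → D ≤ actStab φ (traceP φ q c w) := by
      intro c w hw d hd
      rw [mem_actStab]
      exact traceP_fixed' φ q c d w ((mem_actStab φ w d).1 (hw hd))
    have m1 : (∏ i ∈ Finset.range q, traceP φ q (b * a ^ i) v) ∈ fixGen φ q :=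
      Subgroup.prod_mem _ fun i _ =>
        key _ (hbi i) _ (htr _ _ hD) (traceP_fixed φ q _ (hA _) v)
    have m2 : traceP φ q a v ∈ fixGen φ q := key _ ha _ (htr _ _ hD) (traceP_fixed φ q _ (hA _) v)
    have m3 : traceP φ q a (traceP φ q b v) ∈ fixGen φ q :=
      key _ ha _ (htr _ _ (htr _ _ hD)) (traceP_fixed φ q _ (hA _) _)
    have m4 : v ^ q ∈ fixGen φ q := by
      have := Subgroup.mul_mem _ m1 m2
      rw [trace_identity φ q hq a b (hA a) v] at this
      exact (Subgroup.mul_mem_cancel_right _ m3).1 this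
    have hco : Nat.Coprime q (orderOf v) := hc.coprime_dvd_right (orderOf_dvd_natCard v)
    obtain ⟨m, hm⟩ := exists_pow_eq_self_of_coprime hco
    rw [← hm]
    exact Subgroup.pow_mem _ m4 m

theorem fixGen_comm {A V : Type} [CommGroup A] [Finite A] [CommGroup V] [Finite V]
    (φ : A →* MulAut V) (q : ℕ) (hq : q.Prime) (hA : ∀ a : A, a ^ q = 1)
    (hc : Nat.Coprime q (Nat.card V)) (v : V) : v ∈ fixGen φ q :=
  fixed_mem_fixGen φ q hq hA hc _ ⊥ v le_rfl bot_le

/-- Restriction of an action to an invariant subgroup. -/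
def restrictAct {A G : Type} [CommGroup A] [Group G] (φ : A →* MulAut G) (H : Subgroup G)
    (hH : ∀ a, ∀ x ∈ H, φ a x ∈ H) : A →* MulAut H where
  toFun a :=
    { toFun := fun x => ⟨φ a x, hH a x x.2⟩
      invFun := fun x => ⟨φ a⁻¹ x, hH a⁻¹ x x.2⟩
      left_inv := fun x => by
        ext; simp
      right_inv := fun x => by
        ext; simp
      map_mul' := fun x y => by
        ext; simp }
  map_one' := by
    ext x; simp
  map_mul' a b := by
    ext x; simp

theorem restrictAct_coe {A G : Type} [CommGroup A] [Group G] (φ : A →* MulAut G) (H : Subgroup G)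
    (hH : ∀ a, ∀ x ∈ H, φ a x ∈ H) (a : A) (x : H) :
    ((restrictAct φ H hH a x : H) : G) = φ a x := rfl

theorem fixGen_restrict {A G : Type} [CommGroup A] [Group G] (φ : A →* MulAut G) (H : Subgroup G)
    (hH : ∀ a, ∀ x ∈ H, φ a x ∈ H) (q : ℕ) :
    (fixGen (restrictAct φ H hH) q).map H.subtype ≤ fixGen φ q := by
  rw [Subgroup.map_le_iff_le_comap]
  unfold fixGen
  rw [Subgroup.closure_le]
  intro x hx
  apply Subgroup.subset_closure
  have : actStab φ (H.subtype x) = actStab (restrictAct φ H hH) x := by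
    ext a
    rw [mem_actStab, mem_actStab, ← Subtype.coe_inj, restrictAct_coe]
    rfl
  show (actStab φ (H.subtype x)).index ≤ q
  rw [this]
  exact hx

theorem mem_center_act {G : Type} [Group G] (e : MulAut G) (x : G)
    (hx : x ∈ Subgroup.center G) : e x ∈ Subgroup.center G := by
  rw [Subgroup.mem_center_iff] at hx ⊢
  intro g
  have := congrArg e (hx (e⁻¹ g))
  simpa using this

/-- The induced action on the central quotient. -/
def quotAct {A G : Type} [CommGroup A] [Group G] (φ : A →* MulAut G) :
    A →* MulAut (G ⧸ Subgroup.center G) where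
  toFun a := QuotientGroup.congr (Subgroup.center G) (Subgroup.center G) (φ a) (by
    ext x
    constructor
    · rintro ⟨y, hy, rfl⟩
      exact mem_center_act (φ a) y hy
    · intro hx
      exact ⟨(φ a)⁻¹ x, mem_center_act _ x hx, by simp⟩)
  map_one' := by
    ext x
    obtain ⟨x, rfl⟩ := QuotientGroup.mk_surjective x
    simp
  map_mul' a b := by
    ext x
    obtain ⟨x, rfl⟩ := QuotientGroup.mk_surjective x
    simp

theorem quotAct_mk {A G : Type} [CommGroup A] [Group G] (φ : A →* MulAut G) (a : A) (x : G) :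
    quotAct φ a (QuotientGroup.mk x) = QuotientGroup.mk (φ a x) := rfl

theorem isPGroup_of_exp {A : Type} [CommGroup A] (q : ℕ) (hA : ∀ a : A, a ^ q = 1) :
    IsPGroup q A := fun a => ⟨1, by rw [pow_one]; exact hA a⟩

/-- Fixed cosets of the centre contain fixed elements. -/
theorem lift_fixed {A G : Type} [CommGroup A] [Finite A] [Group G] [Finite G]
    (φ : A →* MulAut G) (q : ℕ) (hq : q.Prime) (hA : ∀ a : A, a ^ q = 1)
    (hc : Nat.Coprime q (Nat.card G)) (B : Subgroup A) (x : G)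
    (hx : B ≤ actStab (quotAct φ) (QuotientGroup.mk x)) :
    ∃ y : G, (QuotientGroup.mk y : G ⧸ Subgroup.center G) = QuotientGroup.mk x ∧
      B ≤ actStab φ y := by
  haveI : Fact q.Prime := ⟨hq⟩
  let S : Type := {y : G // (QuotientGroup.mk y : G ⧸ Subgroup.center G) = QuotientGroup.mk x}
  have hinv : ∀ b : B, ∀ y : S,
      (QuotientGroup.mk (φ b y.1) : G ⧸ Subgroup.center G) = QuotientGroup.mk x := by
    intro b y
    rw [← quotAct_mk, y.2]
    exact (mem_actStab _ _ _).1 (hx b.2)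
  letI : MulAction B S :=
    { smul := fun b y => ⟨φ b y.1, hinv b y⟩
      one_smul := fun y => Subtype.ext (by
        show φ ((1 : B) : A) y.1 = y.1
        simp)
      mul_smul := fun b c y => Subtype.ext (by
        show φ ((b * c : B) : A) y.1 = φ b (φ c y.1)
        simp) }
  have hcard : Nat.card S = Nat.card (Subgroup.center G) := by
    refine Nat.card_congr
      { toFun := fun y => ⟨x⁻¹ * y.1, QuotientGroup.eq.1 y.2.symm⟩
        invFun := fun z => ⟨x * z.1, (QuotientGroup.eq.2 (by simp)).symm⟩
        left_inv := fun y => Subtype.ext (by simp)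
        right_inv := fun z => Subtype.ext (by simp) }
  have hnd : ¬ q ∣ Nat.card S := by
    rw [hcard, ← Nat.Prime.coprime_iff_not_dvd hq]
    exact hc.coprime_dvd_right (Subgroup.card_subgroup_dvd_card _)
  obtain ⟨y, hy⟩ := ((isPGroup_of_exp q hA).to_subgroup B).nonempty_fixed_point_of_prime_not_dvd_card
    S hnd
  refine ⟨y.1, y.2, fun b hb => ?_⟩
  rw [mem_actStab]
  exact congrArg Subtype.val (hy ⟨b, hb⟩)

theorem fixGen_nilpotent {A : Type} [CommGroup A] [Finite A] (q : ℕ) (hq : q.Prime)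
    (hA : ∀ a : A, a ^ q = 1) (G : Type) [Group G] [Group.IsNilpotent G] :
    ∀ [Finite G] (φ : A →* MulAut G), Nat.Coprime q (Nat.card G) → fixGen φ q = ⊤ := by
  refine Group.nilpotent_center_quotient_ind
    (P := fun G [Group G] [Group.IsNilpotent G] => ∀ [Finite G] (φ : A →* MulAut G),
      Nat.Coprime q (Nat.card G) → fixGen φ q = ⊤) G ?_ ?_
  · intro G _ _ _ φ _
    exact Subsingleton.elim _ _
  · intro G _ _ ih _ φ hc
    have hZ : Subgroup.center G ≤ fixGen φ q := by
      have hinv : ∀ a, ∀ x ∈ Subgroup.center G, φ a x ∈ Subgroup.center G :=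
        fun a x hx => mem_center_act _ x hx
      intro z hz
      letI : CommGroup (Subgroup.center G) :=
        { (inferInstance : Group (Subgroup.center G)) with
          mul_comm := fun x y => Subtype.ext (Subgroup.mem_center_iff.1 y.2 x) }
      have h1 := fixGen_comm (restrictAct φ (Subgroup.center G) hinv) q hq hA
        (hc.coprime_dvd_right (Subgroup.card_subgroup_dvd_card _)) ⟨z, hz⟩
      exact fixGen_restrict φ _ hinv q ⟨⟨z, hz⟩, h1, rfl⟩
    have hQ := ih (quotAct φ) (hc.coprime_dvd_right (Subgroup.card_quotient_dvd_card _))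
    have h2 : fixGen (quotAct φ) q ≤ (fixGen φ q).map (QuotientGroup.mk' (Subgroup.center G)) := by
      conv_lhs => unfold fixGen
      rw [Subgroup.closure_le]
      intro x hx
      obtain ⟨x, rfl⟩ := QuotientGroup.mk_surjective x
      obtain ⟨y, hy, hs⟩ := lift_fixed φ q hq hA hc _ x le_rfl
      refine ⟨y, Subgroup.subset_closure ?_, hy⟩
      exact le_trans (Nat.le_of_dvd (Nat.pos_of_ne_zero Subgroup.FiniteIndex.index_ne_zero)
          (Subgroup.index_dvd_of_le hs)) hx
    rw [hQ] at h2
    rw [Subgroup.eq_top_iff']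
    intro g
    obtain ⟨y, hy, he⟩ := h2 (Subgroup.mem_top (QuotientGroup.mk g))
    have h3 : y⁻¹ * g ∈ Subgroup.center G := QuotientGroup.eq.1 he
    have := Subgroup.mul_mem _ hy (hZ h3)
    simpa using this

theorem exists_invariant_sylow {A G : Type} [CommGroup A] [Finite A] [Group G] [Finite G]
    (φ : A →* MulAut G) (q : ℕ) (hq : q.Prime) (hA : ∀ a : A, a ^ q = 1)
    (hc : Nat.Coprime q (Nat.card G)) (p : ℕ) [Fact p.Prime] :
    ∃ P : Sylow p G, ∀ a, ∀ x ∈ (P : Subgroup G), φ a x ∈ (P : Subgroup G) := by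
  haveI : Fact q.Prime := ⟨hq⟩
  letI : MulDistribMulAction A G := MulDistribMulAction.compHom G φ
  have hnd : ¬ q ∣ Nat.card (Sylow p G) := by
    rw [← Nat.Prime.coprime_iff_not_dvd hq]
    obtain ⟨P⟩ : Nonempty (Sylow p G) := inferInstance
    exact hc.coprime_dvd_right ((Sylow.card_dvd_index P).trans (Subgroup.index_dvd_card _))
  obtain ⟨P, hP⟩ := (isPGroup_of_exp q hA).nonempty_fixed_point_of_prime_not_dvd_card
    (Sylow p G) hnd
  refine ⟨P, fun a x hx => ?_⟩
  have h1 : a • P = P := hP a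
  have h2 : ((a • P : Sylow p G) : Subgroup G) = P := by rw [h1]
  rw [Sylow.pointwise_smul_def] at h2
  rw [← h2]
  exact Subgroup.smul_mem_pointwise_smul x a _ hx

theorem fixGen_top {A G : Type} [CommGroup A] [Finite A] [Group G] [Finite G]
    (φ : A →* MulAut G) (q : ℕ) (hq : q.Prime) (hA : ∀ a : A, a ^ q = 1)
    (hc : Nat.Coprime q (Nat.card G)) : fixGen φ q = ⊤ := by
  apply Subgroup.eq_top_of_card_eq
  refine Nat.dvd_antisymm (Subgroup.card_subgroup_dvd_card _) ?_
  refine (Nat.dvd_iff_prime_pow_dvd_dvd _ _).2 fun p k hp hk => ?_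
  haveI : Fact p.Prime := ⟨hp⟩
  obtain ⟨P, hP⟩ := exists_invariant_sylow φ q hq hA hc p
  haveI : Group.IsNilpotent P := P.2.isNilpotent
  have h1 := fixGen_nilpotent q hq hA P (restrictAct φ P hP)
    (hc.coprime_dvd_right (Subgroup.card_subgroup_dvd_card _))
  have h2 := fixGen_restrict φ P hP q
  rw [h1, ← MonoidHom.range_eq_map, Subgroup.range_subtype] at h2
  exact (P.pow_dvd_card_of_pow_dvd_card hk).trans (Subgroup.card_dvd_of_le h2)

/-- Theorem 1.2 with `c = 1`: there is a function `f` such that whenever `q`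
is a prime and `A` is an elementary abelian `q`-group of order at least `q³` acting
coprimely on a finite group `G` with `C_G(a)` abelian for every `a ∈ A^#`, the group `G`
is nilpotent of class at most `f q`. -/
theorem stmt_14 :
    ∃ f : ℕ → ℕ,
      ∀ (q : ℕ), q.Prime →
      ∀ (A G : Type) (_ : CommGroup A) (_ : Finite A) (_ : Group G) (_ : Finite G),
      ∀ (φ : A →* MulAut G),
        (∀ a : A, a ^ q = 1) → q ^ 3 ≤ Nat.card A →
        Nat.Coprime q (Nat.card G) →
        (∀ a : A, a ≠ 1 →
          ∀ x y : G, φ a x = x → φ a y = y → x * y = y * x) →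
        ∃ _ : Group.IsNilpotent G, Group.nilpotencyClass G ≤ f q := by
  refine ⟨fun _ => 1, ?_⟩
  intro q hq A G _ _ _ _ φ hA hcard hc hab
  have htop := fixGen_top φ q hq hA hc
  have hcomm : ∀ x ∈ {x : G | (actStab φ x).index ≤ q}, ∀ y ∈ {x : G | (actStab φ x).index ≤ q},
      x * y = y * x := by
    intro x hx y hy
    have hx' : (actStab φ x).index ≤ q := hx
    have hy' : (actStab φ y).index ≤ q := hy
    have h1 : (actStab φ x ⊓ actStab φ y).index ≤ q * q :=
      Subgroup.index_inf_le.trans (Nat.mul_le_mul hx' hy')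
    have h2 : actStab φ x ⊓ actStab φ y ≠ ⊥ := by
      intro h
      rw [h, Subgroup.index_bot] at h1
      have := hq.two_le
      nlinarith [Nat.mul_le_mul this (le_refl (q * q)), Nat.mul_pos hq.pos hq.pos]
    obtain ⟨⟨a, ha⟩, h3⟩ := Subgroup.ne_bot_iff_exists_ne_one.1 h2
    have ha1 : a ≠ 1 := fun e => h3 (Subtype.ext e)
    exact hab a ha1 x y ((mem_actStab _ _ _).1 ha.1) ((mem_actStab _ _ _).1 ha.2)
  have hcl : IsMulCommutative (Subgroup.closure {x : G | (actStab φ x).index ≤ q}) :=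
    Subgroup.isMulCommutative_closure hcomm
  have hG : ∀ x y : G, x * y = y * x := by
    intro x y
    have hx : x ∈ Subgroup.closure {x : G | (actStab φ x).index ≤ q} := by
      have : x ∈ fixGen φ q := by rw [htop]; trivial
      exact this
    have hy : y ∈ Subgroup.closure {x : G | (actStab φ x).index ≤ q} := by
      have : y ∈ fixGen φ q := by rw [htop]; trivial
      exact this
    exact setLike_mul_comm hx hy
  haveI : IsMulCommutative G := ⟨⟨hG⟩⟩
  have hnil : Group.IsNilpotent G :=
    @CommGroup.isNilpotent G { (inferInstance : Group G) with mul_comm := hG }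
  exact ⟨hnil, Group.IsNilpotent.nilpotencyClass_le_one_iff.2 inferInstance⟩
end
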